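/- Let k ≥ 2 be an integer, t ∈ (0,1), and z ∈ ℂ with |z| = 1, and suppose (z,t) lies below the φ_e curve. Then B = B_{z,t,k} maps the closed unit disk into itself; for every w with |w| < 1 the iterates B^n(w) converge to the unique fixed point w_𝔻 of B in the open disk; and the family of restrictions {B^n restricted to the closed unit disk : n ∈ ℕ} is not equicontinuous at any point w_0 with |w_0| = 1. -/

import Mathlib

/-- The Blaschke product `B_{z,t,k}(w) = z·((w + t)/(1 + w·t))^k`. -/
noncomputable def Blaschke (z : ℂ) (t : ℝ) (k : ℕ) (w : ℂ) : ℂ :=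
  z * ((w + (t : ℂ)) / (1 + w * (t : ℂ))) ^ k

/-- The root with nonnegative imaginary part of the quadratic
`t·w² + ((k+1)·t² − (k−1))·w + t = 0` (for `t_c ≤ t < 1` the discriminant
`(k+1)²t⁴ − 2(k²+1)t² + (k−1)²` is `≤ 0`, so the root is
`(−b + i·√(−disc))/(2t)` with `b = (k+1)t² − (k−1)`). -/
noncomputable def wbullet (k : ℕ) (t : ℝ) : ℂ :=
  (-((((k : ℂ)) + 1) * (t : ℂ)^2 - ((k : ℂ) - 1)) +
    Complex.I * ((Real.sqrt (-(((k : ℝ) + 1)^2 * t^4 - 2 * ((k : ℝ)^2 + 1) * t^2 +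
      ((k : ℝ) - 1)^2)) : ℝ) : ℂ)) / (2 * (t : ℂ))

/-- The edge angle `φ_e(t) = Arg(w_•(t)·((1 + w_•(t)·t)/(w_•(t) + t))^k)`. -/
noncomputable def phie (k : ℕ) (t : ℝ) : ℝ :=
  (wbullet k t * ((1 + wbullet k t * (t : ℂ)) / (wbullet k t + (t : ℂ))) ^ k).arg

/-- `(z,t)` lies below the `φ_e` curve: either `0 ≤ t < t_c`, or
`t_c ≤ t < 1` and `φ_e(t) < |Arg z| ≤ π`. -/
def belowCurve (k : ℕ) (t : ℝ) (z : ℂ) : Prop :=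
  (0 ≤ t ∧ t < ((k : ℝ) - 1) / ((k : ℝ) + 1)) ∨
  (((k : ℝ) - 1) / ((k : ℝ) + 1) ≤ t ∧ t < 1 ∧ phie k t < |z.arg| ∧ |z.arg| ≤ Real.pi)

open Filter Topology ComplexConjugate

/-- The quantity `(1 - |u|²)(1 - |v|²) / |1 - ūv|²`, which is `1 - ρ(u, v)²` for the
pseudo-hyperbolic distance `ρ` of the unit disk. -/
noncomputable def pick (u v : ℂ) : ℝ :=
  (1 - Complex.normSq u) * (1 - Complex.normSq v) / Complex.normSq (1 - conj u * v)

lemma normSq_lt_one_of_norm_lt_one {u : ℂ} (hu : ‖u‖ < 1) : Complex.normSq u < 1 := by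
  rw [Complex.normSq_eq_norm_sq]
  nlinarith [norm_nonneg u]

lemma one_sub_ne_zero_of_norm_lt_one {q : ℂ} (hq : ‖q‖ < 1) : 1 - q ≠ 0 := by
  intro h
  rw [← sub_eq_zero.mp h] at hq
  simp at hq

lemma norm_conj_mul_lt_one {u v : ℂ} (hu : ‖u‖ ≤ 1) (hv : ‖v‖ < 1) : ‖conj u * v‖ < 1 := by
  rw [norm_mul, RCLike.norm_conj]
  nlinarith [norm_nonneg u, norm_nonneg v]

lemma normSq_one_sub_conj_mul (u v : ℂ) :
    Complex.normSq (1 - conj u * v) =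
      (1 - Complex.normSq u) * (1 - Complex.normSq v) + Complex.normSq (u - v) := by
  simp [Complex.normSq_apply]
  ring

lemma normSq_one_sub_conj_mul_pos {u v : ℂ} (hu : ‖u‖ ≤ 1) (hv : ‖v‖ < 1) :
    0 < Complex.normSq (1 - conj u * v) :=
  Complex.normSq_pos.mpr (one_sub_ne_zero_of_norm_lt_one (norm_conj_mul_lt_one hu hv))

lemma one_sub_pick {u v : ℂ} (hu : ‖u‖ ≤ 1) (hv : ‖v‖ < 1) :
    1 - pick u v = Complex.normSq (u - v) / Complex.normSq (1 - conj u * v) := by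
  have h := (normSq_one_sub_conj_mul_pos hu hv).ne'
  rw [pick, eq_div_iff h, sub_mul, div_mul_cancel₀ _ h, normSq_one_sub_conj_mul]
  ring

lemma pick_le_one {u v : ℂ} (hu : ‖u‖ ≤ 1) (hv : ‖v‖ < 1) : pick u v ≤ 1 := by
  have h := one_sub_pick hu hv
  have : 0 ≤ Complex.normSq (u - v) / Complex.normSq (1 - conj u * v) :=
    div_nonneg (Complex.normSq_nonneg _) (Complex.normSq_nonneg _)
  linarith

lemma pick_pos {u v : ℂ} (hu : ‖u‖ < 1) (hv : ‖v‖ < 1) : 0 < pick u v :=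
  div_pos (mul_pos (sub_pos.mpr (normSq_lt_one_of_norm_lt_one hu))
    (sub_pos.mpr (normSq_lt_one_of_norm_lt_one hv))) (normSq_one_sub_conj_mul_pos hu.le hv)

lemma norm_sub_sq_le_of_pick {u v : ℂ} (hu : ‖u‖ ≤ 1) (hv : ‖v‖ < 1) :
    ‖u - v‖ ^ 2 ≤ 4 * (1 - pick u v) := by
  have h := normSq_one_sub_conj_mul_pos hu hv
  have h4 : Complex.normSq (1 - conj u * v) ≤ 4 := by
    rw [Complex.normSq_eq_norm_sq]
    have h1 : ‖1 - conj u * v‖ ≤ 2 := by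
      have := norm_sub_le (1 : ℂ) (conj u * v)
      have := norm_conj_mul_lt_one hu hv
      rw [norm_one] at *
      linarith
    nlinarith [norm_nonneg (1 - conj u * v)]
  rw [one_sub_pick hu hv, ← Complex.normSq_eq_norm_sq, mul_div_assoc', le_div_iff₀ h]
  nlinarith [Complex.normSq_nonneg (u - v)]

lemma pick_unit_mul {z : ℂ} (hz : ‖z‖ = 1) (u v : ℂ) : pick (z * u) (z * v) = pick u v := by
  have hz' : Complex.normSq z = 1 := by rw [Complex.normSq_eq_norm_sq, hz]; norm_num
  have : conj (z * u) * (z * v) = conj u * v := by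
    have h : conj z * z = 1 := by
      rw [← Complex.normSq_eq_conj_mul_self, hz', Complex.ofReal_one]
    rw [map_mul]
    linear_combination (conj u * v) * h
  rw [pick, pick, this, map_mul, map_mul, hz', one_mul, one_mul]

lemma pick_le_pick_real_mul {r : ℝ} (hr0 : 0 ≤ r) (hr1 : r ≤ 1) {u v : ℂ}
    (hu : ‖u‖ < 1) (hv : ‖v‖ < 1) : pick u v ≤ pick (r * u) (r * v) := by
  have hscale : ∀ w : ℂ, ‖w‖ < 1 → ‖(r : ℂ) * w‖ < 1 := fun w hw => by
    rw [norm_mul, Complex.norm_real, Real.norm_of_nonneg hr0]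
    nlinarith [norm_nonneg w]
  have h1 := one_sub_pick hu.le hv
  have h2 := one_sub_pick (hscale u hu).le (hscale v hv)
  have p1 := normSq_one_sub_conj_mul_pos hu.le hv
  have p2 := normSq_one_sub_conj_mul_pos (hscale u hu).le (hscale v hv)
  suffices Complex.normSq (r * u - r * v) / Complex.normSq (1 - conj (r * u) * (r * v)) ≤
      Complex.normSq (u - v) / Complex.normSq (1 - conj u * v) by linarith
  rw [div_le_div_iff₀ p2 p1]
  have e1 : Complex.normSq (r * u - r * v) = r ^ 2 * Complex.normSq (u - v) := by
    rw [← mul_sub, map_mul, Complex.normSq_ofReal]; ring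
  have e2 : Complex.normSq (1 - conj (r * u) * (r * v)) =
      r ^ 2 * Complex.normSq (1 - conj u * v) +
        (1 - r ^ 2) * (1 - r ^ 2 * Complex.normSq (conj u * v)) := by
    simp [Complex.normSq_apply]
    ring
  have hq : Complex.normSq (conj u * v) < 1 :=
    normSq_lt_one_of_norm_lt_one (norm_conj_mul_lt_one hu.le hv)
  have hr2 : r ^ 2 ≤ 1 := by nlinarith
  have h3 : 0 ≤ (1 - r ^ 2) * (1 - r ^ 2 * Complex.normSq (conj u * v)) :=
    mul_nonneg (by linarith)
      (by nlinarith [Complex.normSq_nonneg (conj u * v), sq_nonneg r])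
  rw [e1, e2]
  nlinarith [mul_nonneg (Complex.normSq_nonneg (u - v)) h3]

/-- Strict Cauchy–Schwarz inequality for the vectors of powers of `u` and of `v`. -/
lemma norm_geom_sum_sq_lt {u v : ℂ} (huv : u ≠ v) {k : ℕ} (hk : 2 ≤ k) :
    ‖∑ j ∈ Finset.range k, (conj u * v) ^ j‖ ^ 2 <
      (∑ j ∈ Finset.range k, Complex.normSq u ^ j) *
        ∑ j ∈ Finset.range k, Complex.normSq v ^ j := by
  induction k, hk using Nat.le_induction with
  | base =>
    have h : 0 < Complex.normSq (u - v) := Complex.normSq_pos.mpr (sub_ne_zero.mpr huv)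
    rw [← Complex.normSq_eq_norm_sq]
    simp [Finset.sum_range_succ, Complex.normSq_apply] at h ⊢
    nlinarith
  | succ k hk ih =>
    rw [Finset.sum_range_succ, Finset.sum_range_succ, Finset.sum_range_succ]
    set s := ∑ j ∈ Finset.range k, (conj u * v) ^ j
    have hA : 0 ≤ ∑ j ∈ Finset.range k, Complex.normSq u ^ j :=
      Finset.sum_nonneg fun j _ => pow_nonneg (Complex.normSq_nonneg u) j
    have hB : 0 ≤ ∑ j ∈ Finset.range k, Complex.normSq v ^ j :=
      Finset.sum_nonneg fun j _ => pow_nonneg (Complex.normSq_nonneg v) j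
    set A := ∑ j ∈ Finset.range k, Complex.normSq u ^ j
    set B := ∑ j ∈ Finset.range k, Complex.normSq v ^ j
    have ha : 0 ≤ Complex.normSq u ^ k := pow_nonneg (Complex.normSq_nonneg u) k
    have hb : 0 ≤ Complex.normSq v ^ k := pow_nonneg (Complex.normSq_nonneg v) k
    have hQ : ‖(conj u * v) ^ k‖ ^ 2 = Complex.normSq u ^ k * Complex.normSq v ^ k := by
      rw [← Complex.normSq_eq_norm_sq, map_pow, map_mul, Complex.normSq_conj, mul_pow]
    have hn := norm_add_le s ((conj u * v) ^ k)
    have hQ0 := norm_nonneg ((conj u * v) ^ k)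
    set Q := ‖(conj u * v) ^ k‖
    set a := Complex.normSq u ^ k
    set b := Complex.normSq v ^ k
    have hs := norm_nonneg s
    have hcross : 2 * (‖s‖ * Q) ≤ A * b + B * a := by
      refine abs_le_of_sq_le_sq' ?_ (by positivity) |>.2
      have h1 : (‖s‖ * Q) ^ 2 ≤ (A * B) * (a * b) := by
        rw [mul_pow, hQ]
        exact mul_le_mul_of_nonneg_right ih.le (by positivity)
      nlinarith [sq_nonneg (A * b - B * a)]
    have h2 : ‖s + (conj u * v) ^ k‖ ^ 2 ≤ (‖s‖ + Q) ^ 2 :=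
      pow_le_pow_left₀ (norm_nonneg _) hn 2
    nlinarith

lemma pick_lt_pick_pow {u v : ℂ} (hu : ‖u‖ < 1) (hv : ‖v‖ < 1) (huv : u ≠ v) {k : ℕ}
    (hk : 2 ≤ k) : pick u v < pick (u ^ k) (v ^ k) := by
  have hcs := norm_geom_sum_sq_lt huv hk
  have hpow : ∀ w : ℂ, ‖w‖ < 1 → ‖w ^ k‖ < 1 := fun w hw => by
    rw [norm_pow]; exact pow_lt_one₀ (norm_nonneg w) hw (by omega)
  have p1 := normSq_one_sub_conj_mul_pos hu.le hv
  have p2 := normSq_one_sub_conj_mul_pos (hpow u hu).le (hpow v hv)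
  have hu' := normSq_lt_one_of_norm_lt_one hu
  have hv' := normSq_lt_one_of_norm_lt_one hv
  have e : 1 - conj (u ^ k) * v ^ k =
      (1 - conj u * v) * ∑ j ∈ Finset.range k, (conj u * v) ^ j := by
    rw [mul_neg_geom_sum, map_pow, mul_pow]
  have e2 := e ▸ p2
  rw [map_mul] at e2
  rw [pick, pick, e, map_mul, map_pow, map_pow, ← mul_neg_geom_sum (Complex.normSq u),
    ← mul_neg_geom_sum (Complex.normSq v), div_lt_div_iff₀ p1 e2,
    Complex.normSq_eq_norm_sq (∑ j ∈ _, _)]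
  have h : 0 < (1 - Complex.normSq u) * (1 - Complex.normSq v) *
      Complex.normSq (1 - conj u * v) :=
    mul_pos (mul_pos (by linarith) (by linarith)) p1
  have := mul_lt_mul_of_pos_left hcs h
  linarith

/-- The disk automorphism underlying the Blaschke product. -/
noncomputable def shift (t : ℝ) (w : ℂ) : ℂ := (w + t) / (1 + w * t)

lemma one_add_mul_ne_zero {t : ℝ} (ht0 : 0 < t) (ht1 : t < 1) {w : ℂ} (hw : ‖w‖ ≤ 1) :
    1 + w * (t : ℂ) ≠ 0 := by
  have : ‖-(w * (t : ℂ))‖ < 1 := by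
    rw [norm_neg, norm_mul, Complex.norm_real, Real.norm_of_nonneg ht0.le]
    nlinarith
  simpa using one_sub_ne_zero_of_norm_lt_one this

lemma one_sub_normSq_shift {t : ℝ} {w : ℂ} (h : 1 + w * (t : ℂ) ≠ 0) :
    1 - Complex.normSq (shift t w) =
      (1 - t ^ 2) * (1 - Complex.normSq w) / Complex.normSq (1 + w * t) := by
  have h' := (Complex.normSq_pos.mpr h).ne'
  rw [shift, map_div₀, eq_div_iff h', sub_mul, div_mul_cancel₀ _ h']
  simp [Complex.normSq_apply]
  ring

lemma pick_shift {t : ℝ} (ht : t ^ 2 < 1) {u v : ℂ} (hu : 1 + u * (t : ℂ) ≠ 0)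
    (hv : 1 + v * (t : ℂ) ≠ 0) : pick (shift t u) (shift t v) = pick u v := by
  have hu' : 1 + conj u * (t : ℂ) ≠ 0 := by
    intro h; apply hu; simpa using congrArg conj h
  have e : 1 - conj (shift t u) * shift t v =
      (1 - t ^ 2 : ℝ) * (1 - conj u * v) / ((1 + conj u * t) * (1 + v * t)) := by
    simp only [shift, map_div₀, map_add, map_mul, map_one, Complex.conj_ofReal]
    rw [div_mul_div_comm, eq_div_iff (mul_ne_zero hu' hv), sub_mul,
      div_mul_cancel₀ _ (mul_ne_zero hu' hv)]
    push_cast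
    ring
  have e' : Complex.normSq (1 + conj u * (t : ℂ)) = Complex.normSq (1 + u * t) := by
    rw [← Complex.normSq_conj]; simp
  have n1 := (Complex.normSq_pos.mpr hu).ne'
  have n2 := (Complex.normSq_pos.mpr hv).ne'
  have n3 : 1 - t ^ 2 ≠ 0 := by linarith
  rw [pick, pick, one_sub_normSq_shift hu, one_sub_normSq_shift hv, e, map_div₀, map_mul,
    map_mul, e', Complex.normSq_ofReal]
  generalize Complex.normSq (1 + u * (t : ℂ)) = a at n1 ⊢
  generalize Complex.normSq (1 + v * (t : ℂ)) = b at n2 ⊢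
  by_cases h : Complex.normSq (1 - conj u * v) = 0
  · simp [h]
  · generalize Complex.normSq (1 - conj u * v) = c at h ⊢
    field_simp

lemma Blaschke_eq (z : ℂ) (t : ℝ) (k : ℕ) (w : ℂ) : Blaschke z t k w = z * shift t w ^ k := rfl

section Disk

variable {k : ℕ} {t : ℝ} {z : ℂ}

lemma norm_shift_lt_one (ht0 : 0 < t) (ht1 : t < 1) {w : ℂ} (hw : ‖w‖ < 1) :
    ‖shift t w‖ < 1 := by
  have h := one_add_mul_ne_zero ht0 ht1 hw.le
  have h1 := one_sub_normSq_shift h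
  have h2 : 0 < (1 - t ^ 2) * (1 - Complex.normSq w) / Complex.normSq (1 + w * t) :=
    div_pos (mul_pos (by nlinarith) (sub_pos.mpr (normSq_lt_one_of_norm_lt_one hw)))
      (Complex.normSq_pos.mpr h)
  rw [← h1, Complex.normSq_eq_norm_sq] at h2
  nlinarith [norm_nonneg (shift t w)]

lemma norm_shift_eq_one (ht0 : 0 < t) (ht1 : t < 1) {w : ℂ} (hw : ‖w‖ = 1) :
    ‖shift t w‖ = 1 := by
  have h1 := one_sub_normSq_shift (one_add_mul_ne_zero ht0 ht1 hw.le)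
  rw [Complex.normSq_eq_norm_sq w, hw, Complex.normSq_eq_norm_sq] at h1
  have h2 : ‖shift t w‖ ^ 2 = 1 := by simp at h1; linarith
  exact (pow_eq_one_iff_of_nonneg (norm_nonneg _) two_ne_zero).mp h2

lemma norm_Blaschke (hz : ‖z‖ = 1) (w : ℂ) : ‖Blaschke z t k w‖ = ‖shift t w‖ ^ k := by
  rw [Blaschke_eq, norm_mul, hz, one_mul, norm_pow]

lemma norm_Blaschke_lt_one (hk : k ≠ 0) (ht0 : 0 < t) (ht1 : t < 1) (hz : ‖z‖ = 1) {w : ℂ}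
    (hw : ‖w‖ < 1) : ‖Blaschke z t k w‖ < 1 := by
  rw [norm_Blaschke hz]
  exact pow_lt_one₀ (norm_nonneg _) (norm_shift_lt_one ht0 ht1 hw) hk

lemma norm_Blaschke_eq_one (ht0 : 0 < t) (ht1 : t < 1) (hz : ‖z‖ = 1) {w : ℂ}
    (hw : ‖w‖ = 1) : ‖Blaschke z t k w‖ = 1 := by
  rw [norm_Blaschke hz, norm_shift_eq_one ht0 ht1 hw, one_pow]

lemma mapsTo_Blaschke_closedBall (hk : k ≠ 0) (ht0 : 0 < t) (ht1 : t < 1) (hz : ‖z‖ = 1) :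
    Set.MapsTo (Blaschke z t k) (Metric.closedBall 0 1) (Metric.closedBall 0 1) := by
  intro w hw
  rw [mem_closedBall_zero_iff] at hw ⊢
  rcases hw.lt_or_eq with h | h
  · exact (norm_Blaschke_lt_one hk ht0 ht1 hz h).le
  · exact (norm_Blaschke_eq_one ht0 ht1 hz h).le

lemma continuousAt_shift (ht0 : 0 < t) (ht1 : t < 1) {w : ℂ} (hw : ‖w‖ ≤ 1) :
    ContinuousAt (shift t) w :=
  ContinuousAt.div (by fun_prop) (by fun_prop) (one_add_mul_ne_zero ht0 ht1 hw)

lemma continuousAt_Blaschke (ht0 : 0 < t) (ht1 : t < 1) {w : ℂ} (hw : ‖w‖ ≤ 1) :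
    ContinuousAt (Blaschke z t k) w :=
  continuousAt_const.mul ((continuousAt_shift ht0 ht1 hw).pow k)

lemma pick_lt_pick_Blaschke (hk : 2 ≤ k) (ht0 : 0 < t) (ht1 : t < 1) (hz : ‖z‖ = 1) {u v : ℂ}
    (hu : ‖u‖ < 1) (hv : ‖v‖ < 1) (huv : u ≠ v) :
    pick u v < pick (Blaschke z t k u) (Blaschke z t k v) := by
  have hu' := one_add_mul_ne_zero ht0 ht1 hu.le
  have hv' := one_add_mul_ne_zero ht0 ht1 hv.le
  have ht : t ^ 2 < 1 := by nlinarith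
  have hpick := pick_shift ht hu' hv'
  rw [Blaschke_eq, Blaschke_eq, pick_unit_mul hz, ← hpick]
  have hsu := norm_shift_lt_one ht0 ht1 hu
  have hsv := norm_shift_lt_one ht0 ht1 hv
  refine pick_lt_pick_pow hsu hsv (fun h => huv ?_) hk
  have h0 := one_sub_pick hsu.le hsv
  rw [hpick, one_sub_pick hu.le hv, h, sub_self, map_zero, zero_div, div_eq_zero_iff] at h0
  rcases h0 with h0 | h0
  · exact sub_eq_zero.mp (Complex.normSq_eq_zero.mp h0)
  · exact absurd h0 (normSq_one_sub_conj_mul_pos hu.le hv).ne'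

lemma continuousAt_pick {u v : ℂ} (hu : ‖u‖ ≤ 1) (hv : ‖v‖ < 1) :
    ContinuousAt (fun p : ℂ × ℂ => pick p.1 p.2) (u, v) := by
  unfold pick
  refine ContinuousAt.div ?_ ?_ (normSq_one_sub_conj_mul_pos hu hv).ne'
  · have := Complex.continuous_normSq
    fun_prop
  · have := Complex.continuous_normSq
    have := Complex.continuous_conj
    fun_prop

/-- A map of the open disk contracting the pseudo-hyperbolic distance and having relatively compact
image has a fixed point: the displacement is minimal somewhere. -/
lemma exists_fixedPoint_real_mul_Blaschke (hk : 2 ≤ k) (ht0 : 0 < t) (ht1 : t < 1)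
    (hz : ‖z‖ = 1) {r : ℝ} (hr0 : 0 ≤ r) (hr1 : r < 1) :
    ∃ x : ℂ, ‖x‖ ≤ r ∧ (r : ℂ) * Blaschke z t k x = x := by
  have hball : ∀ x ∈ Metric.closedBall (0 : ℂ) r, ‖x‖ < 1 := fun x hx => by
    rw [mem_closedBall_zero_iff] at hx; linarith
  have hB : ∀ x ∈ Metric.closedBall (0 : ℂ) r, ‖(r : ℂ) * Blaschke z t k x‖ ≤ r := fun x hx => by
    rw [norm_mul, Complex.norm_real, Real.norm_of_nonneg hr0]
    have := norm_Blaschke_lt_one (k := k) (by omega) ht0 ht1 hz (hball x hx)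
    nlinarith
  have hcont : ContinuousOn (fun x => pick ((r : ℂ) * Blaschke z t k x) x)
      (Metric.closedBall (0 : ℂ) r) := by
    intro x hx
    apply ContinuousAt.continuousWithinAt
    have h1 : ContinuousAt (fun x => ((r : ℂ) * Blaschke z t k x, x)) x :=
      (continuousAt_const.mul (continuousAt_Blaschke ht0 ht1 (hball x hx).le)).prodMk
        continuousAt_id
    exact ContinuousAt.comp (f := fun x => ((r : ℂ) * Blaschke z t k x, x))
      (continuousAt_pick ((hB x hx).trans hr1.le) (hball x hx)) h1
  obtain ⟨x, hx, hmax⟩ := (isCompact_closedBall (0 : ℂ) r).exists_isMaxOn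
    ⟨0, by simpa using hr0⟩ hcont
  refine ⟨x, by simpa using hx, ?_⟩
  by_contra hne
  have hy : (r : ℂ) * Blaschke z t k x ∈ Metric.closedBall (0 : ℂ) r :=
    mem_closedBall_zero_iff.mpr (hB x hx)
  have h1 := isMaxOn_iff.mp hmax _ hy
  have h2 := pick_lt_pick_Blaschke hk ht0 ht1 hz (hball _ hy) (hball x hx) hne
  have h3 := pick_le_pick_real_mul hr0 hr1.le
    (norm_Blaschke_lt_one (k := k) (by omega) ht0 ht1 hz (hball _ hy))
    (norm_Blaschke_lt_one (k := k) (by omega) ht0 ht1 hz (hball x hx))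
  linarith

/-- An interior fixed point exists unless some fixed point on the circle is not repelling. -/
lemma exists_fixedPoint_or_not_repelling (hk : 2 ≤ k) (ht0 : 0 < t) (ht1 : t < 1)
    (hz : ‖z‖ = 1) :
    ∃ x : ℂ, Blaschke z t k x = x ∧
      (‖x‖ < 1 ∨ ‖x‖ = 1 ∧ k * (1 - t ^ 2) ≤ Complex.normSq (1 + x * t)) := by
  obtain ⟨r, hrm, hr, hrlim⟩ := exists_seq_strictMono_tendsto' (zero_lt_one' ℝ)
  choose x hxr hx using fun n =>
    exists_fixedPoint_real_mul_Blaschke (k := k) hk ht0 ht1 hz (hr n).1.le (hr n).2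
  obtain ⟨y, hy, φ, hφ, hlim⟩ := (isCompact_closedBall (0 : ℂ) 1).tendsto_subseq
    (x := x) (fun n => mem_closedBall_zero_iff.mpr ((hxr n).trans (hr n).2.le))
  rw [mem_closedBall_zero_iff] at hy
  have hlimB := (continuousAt_Blaschke (k := k) (z := z) ht0 ht1 hy).tendsto.comp hlim
  have hfix : Blaschke z t k y = y := by
    have h1 : Tendsto (fun n => ((r (φ n) : ℝ) : ℂ) * Blaschke z t k (x (φ n))) atTop
        (𝓝 (((1 : ℝ) : ℂ) * Blaschke z t k y)) :=
      ((Complex.continuous_ofReal.tendsto 1).comp (hrlim.comp hφ.tendsto_atTop)).mul hlimB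
    simp only [hx, Complex.ofReal_one, one_mul] at h1
    exact tendsto_nhds_unique h1 hlim
  refine ⟨y, hfix, hy.lt_or_eq.imp_right fun hy1 => ⟨hy1, ?_⟩⟩
  have hineq : ∀ n, (1 - t ^ 2) *
      (∑ j ∈ Finset.range k, Complex.normSq (shift t (x n)) ^ j) ≤
        Complex.normSq (1 + x n * t) := by
    intro n
    have hxn : ‖x n‖ < 1 := (hxr n).trans_lt (hr n).2
    have hne := one_add_mul_ne_zero ht0 ht1 hxn.le
    have hle : Complex.normSq (x n) ≤ Complex.normSq (shift t (x n)) ^ k := by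
      have h1 : ‖x n‖ ≤ ‖shift t (x n)‖ ^ k := by
        rw [← norm_Blaschke hz]
        conv_lhs => rw [← hx n, norm_mul, Complex.norm_real, Real.norm_of_nonneg (hr n).1.le]
        exact mul_le_of_le_one_left (norm_nonneg _) (hr n).2.le
      rw [Complex.normSq_eq_norm_sq, Complex.normSq_eq_norm_sq, ← pow_mul, mul_comm 2 k, pow_mul]
      exact pow_le_pow_left₀ (norm_nonneg _) h1 2
    have h2 := mul_neg_geom_sum (Complex.normSq (shift t (x n))) k
    rw [one_sub_normSq_shift hne, div_mul_eq_mul_div,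
      div_eq_iff (Complex.normSq_pos.mpr hne).ne'] at h2
    have h3 : 0 < 1 - Complex.normSq (x n) := sub_pos.mpr (normSq_lt_one_of_norm_lt_one hxn)
    have h4 := Complex.normSq_nonneg (1 + x n * t)
    refine le_of_mul_le_mul_left ?_ h3
    nlinarith
  have hL : Tendsto (fun n => (1 - t ^ 2) *
      (∑ j ∈ Finset.range k, Complex.normSq (shift t (x (φ n))) ^ j)) atTop
      (𝓝 ((1 - t ^ 2) * (∑ j ∈ Finset.range k, Complex.normSq (shift t y) ^ j))) := by
    refine Tendsto.const_mul _ (tendsto_finsetSum _ fun j _ => Tendsto.pow ?_ j)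
    exact (Complex.continuous_normSq.tendsto _).comp
      ((continuousAt_shift ht0 ht1 hy).tendsto.comp hlim)
  have hR : Tendsto (fun n => Complex.normSq (1 + x (φ n) * t)) atTop
      (𝓝 (Complex.normSq (1 + y * t))) :=
    (Complex.continuous_normSq.tendsto _).comp ((hlim.mul_const _).const_add _)
  have := le_of_tendsto_of_tendsto' hL hR fun n => hineq (φ n)
  rw [Complex.normSq_eq_norm_sq (shift t y), norm_shift_eq_one ht0 ht1 hy1] at this
  simpa [mul_comm] using this

lemma tendsto_iterate_Blaschke (hk : 2 ≤ k) (ht0 : 0 < t) (ht1 : t < 1) (hz : ‖z‖ = 1) {p : ℂ}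
    (hp : ‖p‖ < 1) (hfix : Blaschke z t k p = p) {w : ℂ} (hw : ‖w‖ < 1) :
    Tendsto (fun n : ℕ => (Blaschke z t k)^[n] w) atTop (𝓝 p) := by
  have horb : ∀ n, ‖(Blaschke z t k)^[n] w‖ < 1 := by
    intro n
    induction n with
    | zero => exact hw
    | succ n ih =>
      rw [Function.iterate_succ_apply']
      exact norm_Blaschke_lt_one (by omega) ht0 ht1 hz ih
  set x : ℕ → ℂ := fun n => (Blaschke z t k)^[n] w with hxdef
  have hsucc : ∀ n, x (n + 1) = Blaschke z t k (x n) := fun n =>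
    Function.iterate_succ_apply' _ _ _
  have hmono : Monotone fun n => pick (x n) p := by
    refine monotone_nat_of_le_succ fun n => ?_
    rw [hsucc]
    by_cases h : x n = p
    · rw [h, hfix]
    · have := pick_lt_pick_Blaschke hk ht0 ht1 hz (horb n) hp h
      rw [hfix] at this
      exact this.le
  have hbdd : BddAbove (Set.range fun n => pick (x n) p) := by
    refine ⟨1, ?_⟩
    rintro _ ⟨n, rfl⟩
    exact pick_le_one (horb n).le hp
  have hlim := tendsto_atTop_ciSup hmono hbdd
  set L := ⨆ n, pick (x n) p
  have hLpos : 0 < L := (pick_pos hw hp).trans_le (hmono.ge_of_tendsto hlim 0)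
  have hcp : ∀ y : ℂ, ‖y‖ ≤ 1 → ContinuousAt (fun u => pick u p) y := fun y hy =>
    ContinuousAt.comp (f := fun u : ℂ => (u, p)) (continuousAt_pick hy hp) (by fun_prop)
  obtain ⟨y, hy, φ, hφ, hsub⟩ := (isCompact_closedBall (0 : ℂ) 1).tendsto_subseq
    (x := x) (fun n => mem_closedBall_zero_iff.mpr (horb n).le)
  rw [mem_closedBall_zero_iff] at hy
  have hyL : pick y p = L :=
    tendsto_nhds_unique ((hcp y hy).tendsto.comp hsub) (hlim.comp hφ.tendsto_atTop)
  have hy1 : ‖y‖ < 1 := by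
    refine hy.lt_of_ne fun h => hLpos.ne ?_
    rw [← hyL, pick, Complex.normSq_eq_norm_sq y, h]
    simp
  have hByL : pick (Blaschke z t k y) p = L := by
    have h1 := (hcp _ (norm_Blaschke_lt_one (k := k) (by omega) ht0 ht1 hz hy1).le).tendsto.comp
      ((continuousAt_Blaschke (k := k) (z := z) ht0 ht1 hy).tendsto.comp hsub)
    refine tendsto_nhds_unique h1 ?_
    have h2 := (hlim.comp (tendsto_add_atTop_nat 1)).comp hφ.tendsto_atTop
    refine h2.congr fun n => ?_
    simp only [Function.comp_apply, hsucc]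
  have hyp : y = p := by
    by_contra h
    have := pick_lt_pick_Blaschke hk ht0 ht1 hz hy1 hp h
    rw [hfix, hByL, hyL] at this
    exact lt_irrefl _ this
  have hL1 : L = 1 := by
    have := one_sub_pick hy hp
    rw [hyL, hyp, sub_self, map_zero, zero_div] at this
    linarith
  have hsq : Tendsto (fun n => ‖x n - p‖ ^ 2) atTop (𝓝 0) := by
    refine squeeze_zero (fun n => by positivity)
      (fun n => norm_sub_sq_le_of_pick (horb n).le hp) ?_
    have := (hlim.const_sub 1).const_mul 4
    rwa [hL1, sub_self, mul_zero] at this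
  rw [tendsto_iff_norm_sub_tendsto_zero]
  have := hsq.sqrt
  simpa [Real.sqrt_sq] using this

lemma eq_of_isFixedPt_Blaschke (hk : 2 ≤ k) (ht0 : 0 < t) (ht1 : t < 1) (hz : ‖z‖ = 1) {p w : ℂ}
    (hp : ‖p‖ < 1) (hfp : Blaschke z t k p = p) (hw : ‖w‖ < 1) (hfw : Blaschke z t k w = w) :
    w = p := by
  by_contra h
  have := pick_lt_pick_Blaschke hk ht0 ht1 hz hw hp h
  rw [hfp, hfw] at this
  exact lt_irrefl _ this

lemma not_equicontinuousAt_iterate_Blaschke (hk : 2 ≤ k) (ht0 : 0 < t) (ht1 : t < 1)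
    (hz : ‖z‖ = 1) {p : ℂ} (hp : ‖p‖ < 1) (hfix : Blaschke z t k p = p)
    (w0 : Metric.closedBall (0 : ℂ) 1) (hw0 : ‖(w0 : ℂ)‖ = 1) :
    ¬ EquicontinuousAt
      (fun (n : ℕ) (w : Metric.closedBall (0 : ℂ) 1) => (Blaschke z t k)^[n] (w : ℂ)) w0 := by
  intro heq
  rw [Metric.equicontinuousAt_iff] at heq
  obtain ⟨δ, hδ, h⟩ := heq ((1 - ‖p‖) / 2) (by linarith)
  obtain ⟨s, hs0, hs1⟩ := exists_between (lt_min hδ one_pos)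
  obtain ⟨hsδ, hs1⟩ := lt_min_iff.mp hs1
  have hw : ‖((1 - s : ℝ) : ℂ) * w0‖ < 1 := by
    rw [norm_mul, hw0, Complex.norm_real, Real.norm_of_nonneg (by linarith)]
    linarith
  have hd : ∀ n, 1 - ‖(Blaschke z t k)^[n] (((1 - s : ℝ) : ℂ) * w0)‖ ≤ (1 - ‖p‖) / 2 := by
    intro n
    have hn : ‖(Blaschke z t k)^[n] (w0 : ℂ)‖ = 1 := by
      induction n with
      | zero => exact hw0
      | succ n ih =>
        rw [Function.iterate_succ_apply']
        exact norm_Blaschke_eq_one ht0 ht1 hz ih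
    have h1 := h ⟨((1 - s : ℝ) : ℂ) * w0, mem_closedBall_zero_iff.mpr hw.le⟩ (by
      rw [Subtype.dist_eq, dist_eq_norm]
      have : ((1 - s : ℝ) : ℂ) * w0 - w0 = ((-s : ℝ) : ℂ) * w0 := by push_cast; ring
      simp only [this]
      rw [norm_mul, hw0, Complex.norm_real, norm_neg, Real.norm_of_nonneg hs0.le]
      linarith) n
    rw [dist_eq_norm] at h1
    have h2 := norm_sub_norm_le ((Blaschke z t k)^[n] (w0 : ℂ))
      ((Blaschke z t k)^[n] (((1 - s : ℝ) : ℂ) * w0))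
    rw [hn] at h2
    linarith
  have hlim := (tendsto_iterate_Blaschke hk ht0 ht1 hz hp hfix hw).norm.const_sub 1
  have := le_of_tendsto' hlim hd
  linarith

end Disk

/-- The continuous determination, vanishing at `θ = 0`, of the argument of
`w * ((1 + w * t) / (w + t)) ^ k` at `w = exp (i θ)`. -/
noncomputable def liftedArg (k : ℕ) (t θ : ℝ) : ℝ :=
  θ + k * (2 * Real.arctan (t * Real.sin θ / (1 + t * Real.cos θ)) - θ)

section LiftedArg

variable {k : ℕ} {t : ℝ}

lemma one_add_mul_cos_pos (ht0 : 0 < t) (ht1 : t < 1) (θ : ℝ) : 0 < 1 + t * Real.cos θ := by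
  nlinarith [Real.neg_one_le_cos θ]

lemma exp_two_mul_arctan_mul_I (x : ℝ) :
    Complex.exp ((2 * Real.arctan x : ℝ) * Complex.I) * (1 - x * Complex.I) =
      1 + x * Complex.I := by
  have hc : (Real.cos (Real.arctan x) : ℂ) ≠ 0 := by
    exact_mod_cast (Real.cos_arctan_pos x).ne'
  have hs : (Real.sin (Real.arctan x) : ℂ) = x * Real.cos (Real.arctan x) := by
    have := Real.tan_mul_cos (Real.cos_arctan_pos x).ne'
    rw [Real.tan_arctan] at this
    exact_mod_cast this.symm
  have h1 : Complex.exp ((2 * Real.arctan x : ℝ) * Complex.I) *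
      Complex.exp ((-Real.arctan x : ℝ) * Complex.I) =
        Complex.exp ((Real.arctan x : ℝ) * Complex.I) := by
    rw [← Complex.exp_add]
    congr 1
    push_cast
    ring
  rw [Complex.exp_mul_I ((-Real.arctan x : ℝ) : ℂ), Complex.exp_mul_I (Real.arctan x : ℂ),
    ← Complex.ofReal_cos, ← Complex.ofReal_sin, ← Complex.ofReal_cos, ← Complex.ofReal_sin,
    Real.cos_neg, Real.sin_neg, Complex.ofReal_neg, hs] at h1
  apply mul_right_cancel₀ hc
  linear_combination h1

lemma exp_liftedArg_mul_I (ht0 : 0 < t) (ht1 : t < 1) (θ : ℝ) :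
    Complex.exp (θ * Complex.I) * ((1 + Complex.exp (θ * Complex.I) * t) /
      (Complex.exp (θ * Complex.I) + t)) ^ k = Complex.exp (liftedArg k t θ * Complex.I) := by
  have hw : ‖Complex.exp (θ * Complex.I)‖ = 1 := Complex.norm_exp_ofReal_mul_I θ
  have hpos := one_add_mul_cos_pos ht0 ht1 θ
  have hpos' : (1 + t * Real.cos θ : ℂ) ≠ 0 := by exact_mod_cast hpos.ne'
  have hden : Complex.exp (θ * Complex.I) + t ≠ 0 := by
    intro h
    rw [eq_neg_of_add_eq_zero_left h, norm_neg, Complex.norm_real,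
      Real.norm_of_nonneg ht0.le] at hw
    linarith
  have hcs : (Real.cos θ : ℂ) ^ 2 + (Real.sin θ : ℂ) ^ 2 = 1 := by
    exact_mod_cast Real.cos_sq_add_sin_sq θ
  have key : (1 + Complex.exp (θ * Complex.I) * t) / (Complex.exp (θ * Complex.I) + t) =
      Complex.exp ((2 * Real.arctan (t * Real.sin θ / (1 + t * Real.cos θ)) - θ : ℝ) *
        Complex.I) := by
    have h1 := exp_two_mul_arctan_mul_I (t * Real.sin θ / (1 + t * Real.cos θ))
    rw [div_eq_iff hden, Complex.ofReal_sub, sub_mul, Complex.exp_sub, div_mul_eq_mul_div,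
      eq_div_iff (Complex.exp_ne_zero _)]
    set E := Complex.exp ((2 * Real.arctan (t * Real.sin θ / (1 + t * Real.cos θ)) : ℝ) *
      Complex.I)
    have h2 : E * ((1 + t * Real.cos θ) - t * Real.sin θ * Complex.I) =
        (1 + t * Real.cos θ) + t * Real.sin θ * Complex.I := by
      push_cast at h1 hpos' ⊢
      field_simp at h1
      linear_combination h1
    rw [Complex.exp_mul_I, ← Complex.ofReal_cos, ← Complex.ofReal_sin]
    linear_combination -(Real.cos θ + Real.sin θ * Complex.I : ℂ) * h2 +
      E * t * (hcs - (Real.sin θ : ℂ) ^ 2 * Complex.I_sq)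
  rw [key, ← Complex.exp_nat_mul, ← Complex.exp_add, liftedArg]
  congr 1
  push_cast
  ring

lemma liftedArg_zero : liftedArg k t 0 = 0 := by simp [liftedArg]

lemma hasDerivAt_liftedArg (ht0 : 0 < t) (ht1 : t < 1) (θ : ℝ) :
    HasDerivAt (liftedArg k t)
      (1 - k * (1 - t ^ 2) / (1 + 2 * t * Real.cos θ + t ^ 2)) θ := by
  have hpos := one_add_mul_cos_pos ht0 ht1 θ
  have hsc := Real.sin_sq_add_cos_sq θ
  have hN : 0 < 1 + 2 * t * Real.cos θ + t ^ 2 := by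
    nlinarith [Real.neg_one_le_cos θ, sq_nonneg (t - 1)]
  have h1 := ((Real.hasDerivAt_sin θ).const_mul t).div
    (((Real.hasDerivAt_cos θ).const_mul t).const_add 1) hpos.ne'
  have h2 := (hasDerivAt_id' θ).add
    (((h1.arctan.const_mul 2).sub (hasDerivAt_id' θ)).const_mul (k : ℝ))
  refine h2.congr_deriv ?_
  simp only [Pi.div_apply]
  have e : 1 + (t * Real.sin θ / (1 + t * Real.cos θ)) ^ 2 =
      (1 + 2 * t * Real.cos θ + t ^ 2) / (1 + t * Real.cos θ) ^ 2 := by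
    field_simp
    linear_combination t ^ 2 * hsc
  have e' : t * Real.cos θ * (1 + t * Real.cos θ) - t * Real.sin θ * (t * -Real.sin θ) =
      t * Real.cos θ + t ^ 2 := by
    linear_combination t ^ 2 * hsc
  rw [e, e']
  field_simp
  ring

lemma liftedArg_le (ht0 : 0 < t) (ht1 : t < 1) {θ : ℝ} (hθ : 0 ≤ θ) : liftedArg k t θ ≤ θ := by
  have hanti : AntitoneOn (fun x => liftedArg k t x - x) Set.univ := by
    have hd := fun x => (hasDerivAt_liftedArg (k := k) ht0 ht1 x).sub (hasDerivAt_id' x)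
    refine antitoneOn_of_deriv_nonpos convex_univ
      (fun x _ => (hd x).continuousAt.continuousWithinAt)
      (fun x _ => (hd x).differentiableAt.differentiableWithinAt) fun x _ => ?_
    have hN : 0 < 1 + 2 * t * Real.cos x + t ^ 2 := by
      nlinarith [Real.neg_one_le_cos x, sq_nonneg (t - 1)]
    have : 0 ≤ k * (1 - t ^ 2) / (1 + 2 * t * Real.cos x + t ^ 2) :=
      div_nonneg (mul_nonneg k.cast_nonneg (by nlinarith)) hN.le
    rw [show deriv (fun x => liftedArg k t x - x) x = _ from (hd x).deriv]
    linarith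
  have := hanti (Set.mem_univ 0) (Set.mem_univ θ) hθ
  simp only [liftedArg_zero] at this
  linarith

lemma monotoneOn_liftedArg (ht0 : 0 < t) (ht1 : t < 1) {α : ℝ} (hα : α ≤ Real.pi)
    (h : k * (1 - t ^ 2) ≤ 1 + 2 * t * Real.cos α + t ^ 2) :
    MonotoneOn (liftedArg k t) (Set.Icc 0 α) := by
  have hd := fun x => hasDerivAt_liftedArg (k := k) ht0 ht1 x
  refine monotoneOn_of_deriv_nonneg (convex_Icc 0 α)
    (fun x _ => (hd x).continuousAt.continuousWithinAt)
    (fun x _ => (hd x).differentiableAt.differentiableWithinAt) fun x hx => ?_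
  rw [interior_Icc] at hx
  have hN : 0 < 1 + 2 * t * Real.cos x + t ^ 2 := by
    nlinarith [Real.neg_one_le_cos x, sq_nonneg (t - 1)]
  have hcos := Real.cos_le_cos_of_nonneg_of_le_pi hx.1.le hα hx.2.le
  rw [(hd x).deriv, sub_nonneg, div_le_one hN]
  nlinarith

lemma arg_exp_mul_I_of_mem {x : ℝ} (h0 : 0 ≤ x) (h1 : x ≤ Real.pi) :
    (Complex.exp (x * Complex.I)).arg = x := by
  rw [Complex.exp_mul_I]
  exact Complex.arg_cos_add_sin_mul_I ⟨by linarith [Real.pi_pos], h1⟩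

/-- The cosine of the argument of `wbullet k t`. -/
noncomputable def bulletCos (k : ℕ) (t : ℝ) : ℝ := ((k - 1) - (k + 1) * t ^ 2) / (2 * t)

lemma two_mul_bulletCos (ht0 : 0 < t) : 2 * t * bulletCos k t = (k - 1) - (k + 1) * t ^ 2 :=
  mul_div_cancel₀ _ (by positivity)

lemma neg_one_le_bulletCos (hk : 2 ≤ k) (ht0 : 0 < t) (ht1 : t < 1) : -1 ≤ bulletCos k t := by
  have hk' : (2 : ℝ) ≤ k := by exact_mod_cast hk
  have h : 0 ≤ (1 - t) * ((k - 1) + (k + 1) * t) :=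
    mul_nonneg (by linarith) (by nlinarith)
  rw [bulletCos, le_div_iff₀ (by positivity)]
  nlinarith

lemma bulletCos_le_one (ht0 : 0 < t) (htc : ((k : ℝ) - 1) / (k + 1) ≤ t) :
    bulletCos k t ≤ 1 := by
  rw [div_le_iff₀ (by positivity)] at htc
  have h : 0 ≤ (1 + t) * ((k + 1) * t - (k - 1)) := mul_nonneg (by linarith) (by linarith)
  rw [bulletCos, div_le_iff₀ (by positivity)]
  nlinarith

lemma wbullet_eq_exp (hk : 2 ≤ k) (ht0 : 0 < t) (ht1 : t < 1)
    (htc : ((k : ℝ) - 1) / (k + 1) ≤ t) :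
    wbullet k t = Complex.exp (Real.arccos (bulletCos k t) * Complex.I) := by
  have hc := two_mul_bulletCos (k := k) ht0
  have ht : (t : ℂ) ≠ 0 := by exact_mod_cast ht0.ne'
  have hsqrt : Real.sqrt (-(((k : ℝ) + 1) ^ 2 * t ^ 4 - 2 * ((k : ℝ) ^ 2 + 1) * t ^ 2 +
      ((k : ℝ) - 1) ^ 2)) = 2 * t * Real.sqrt (1 - bulletCos k t ^ 2) := by
    rw [← Real.sqrt_sq (by positivity : 0 ≤ 2 * t), ← Real.sqrt_mul (sq_nonneg _)]
    congr 1
    linear_combination (2 * t * bulletCos k t + ((k - 1) - (k + 1) * t ^ 2)) * hc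
  have hcC : (2 * t * bulletCos k t : ℂ) = (k - 1) - (k + 1) * t ^ 2 := by exact_mod_cast hc
  rw [Complex.exp_mul_I, ← Complex.ofReal_cos, ← Complex.ofReal_sin, Real.sin_arccos,
    Real.cos_arccos (neg_one_le_bulletCos hk ht0 ht1) (bulletCos_le_one ht0 htc), wbullet, hsqrt,
    div_eq_iff (by simpa using ht)]
  push_cast
  linear_combination -hcC

lemma phie_eq_liftedArg (hk : 2 ≤ k) (ht0 : 0 < t) (ht1 : t < 1)
    (htc : ((k : ℝ) - 1) / (k + 1) ≤ t) :
    phie k t = liftedArg k t (Real.arccos (bulletCos k t)) := by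
  have hα0 := Real.arccos_nonneg (bulletCos k t)
  have hαπ := Real.arccos_le_pi (bulletCos k t)
  have hmono := monotoneOn_liftedArg (k := k) ht0 ht1 hαπ (by
    rw [Real.cos_arccos (neg_one_le_bulletCos hk ht0 ht1) (bulletCos_le_one ht0 htc),
      two_mul_bulletCos ht0]
    linarith)
  have h0 := hmono ⟨le_rfl, hα0⟩ ⟨hα0, le_rfl⟩ hα0
  rw [liftedArg_zero] at h0
  rw [phie, wbullet_eq_exp hk ht0 ht1 htc, exp_liftedArg_mul_I ht0 ht1]
  exact arg_exp_mul_I_of_mem h0 ((liftedArg_le ht0 ht1 hα0).trans hαπ)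

lemma le_bulletCos_of_not_repelling (ht0 : 0 < t) {θ : ℝ}
    (h : k * (1 - t ^ 2) ≤ 1 + 2 * t * Real.cos θ + t ^ 2) : bulletCos k t ≤ Real.cos θ := by
  rw [bulletCos, div_le_iff₀ (by positivity)]
  linarith

lemma abs_arg_le_phie (hk : 2 ≤ k) (ht0 : 0 < t) (ht1 : t < 1)
    (htc : ((k : ℝ) - 1) / (k + 1) ≤ t) {θ : ℝ} (hθ0 : 0 ≤ θ) (hθπ : θ ≤ Real.pi)
    (h : k * (1 - t ^ 2) ≤ 1 + 2 * t * Real.cos θ + t ^ 2) :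
    |(Complex.exp (liftedArg k t θ * Complex.I)).arg| ≤ phie k t := by
  have hαπ := Real.arccos_le_pi (bulletCos k t)
  have hθα : θ ≤ Real.arccos (bulletCos k t) := by
    rw [← Real.arccos_cos hθ0 hθπ]
    exact Real.arccos_le_arccos (le_bulletCos_of_not_repelling ht0 h)
  have hmono := monotoneOn_liftedArg (k := k) ht0 ht1 hαπ (by
    rw [Real.cos_arccos (neg_one_le_bulletCos hk ht0 ht1) (bulletCos_le_one ht0 htc),
      two_mul_bulletCos ht0]
    linarith)
  have h0 := hmono ⟨le_rfl, hθ0.trans hθα⟩ ⟨hθ0, hθα⟩ hθ0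
  have h1 := hmono ⟨hθ0, hθα⟩ ⟨hθ0.trans hθα, le_rfl⟩ hθα
  rw [liftedArg_zero] at h0
  rw [arg_exp_mul_I_of_mem h0 ((liftedArg_le ht0 ht1 hθ0).trans hθπ), abs_of_nonneg h0,
    phie_eq_liftedArg hk ht0 ht1 htc]
  exact h1

end LiftedArg

lemma abs_arg_conj (w : ℂ) : |(conj w).arg| = |w.arg| := by
  rw [Complex.arg_conj]
  split_ifs with h
  · rw [h]
  · rw [abs_neg]

lemma normSq_one_add_exp_mul (t θ : ℝ) :
    Complex.normSq (1 + Complex.exp (θ * Complex.I) * t) = 1 + 2 * t * Real.cos θ + t ^ 2 := by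
  rw [Complex.normSq_apply]
  simp [Complex.exp_ofReal_mul_I_re, Complex.exp_ofReal_mul_I_im]
  linear_combination t ^ 2 * Real.sin_sq_add_cos_sq θ

lemma eq_mul_pow_of_Blaschke_eq {k : ℕ} {t : ℝ} {z w : ℂ} (h1 : 1 + w * (t : ℂ) ≠ 0)
    (h2 : w + (t : ℂ) ≠ 0) (h : Blaschke z t k w = w) :
    z = w * ((1 + w * t) / (w + t)) ^ k := by
  have e : (w + t) / (1 + w * t) * ((1 + w * t) / (w + t)) = 1 := by
    rw [div_mul_div_comm, mul_comm, div_self (mul_ne_zero h1 h2)]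
  calc z = z * ((w + t) / (1 + w * t) * ((1 + w * t) / (w + t))) ^ k := by
        rw [e, one_pow, mul_one]
    _ = Blaschke z t k w * ((1 + w * t) / (w + t)) ^ k := by rw [mul_pow, ← mul_assoc, Blaschke]
    _ = w * ((1 + w * t) / (w + t)) ^ k := by rw [h]

/-- Below the curve, every fixed point on the unit circle is repelling. -/
lemma normSq_lt_of_belowCurve {k : ℕ} {t : ℝ} {z : ℂ} (hk : 2 ≤ k) (ht0 : 0 < t) (ht1 : t < 1)
    (hbc : belowCurve k t z) {x : ℂ} (hx : ‖x‖ = 1) (hfix : Blaschke z t k x = x) :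
    Complex.normSq (1 + x * t) < k * (1 - t ^ 2) := by
  by_contra! hle
  have hxexp : x = Complex.exp (x.arg * Complex.I) := by
    simpa [hx] using (Complex.norm_mul_exp_arg_mul_I x).symm
  have hle' : k * (1 - t ^ 2) ≤ 1 + 2 * t * Real.cos |x.arg| + t ^ 2 := by
    rw [Real.cos_abs, ← normSq_one_add_exp_mul, ← hxexp]
    exact hle
  rcases hbc with ⟨-, htc⟩ | ⟨htc, -, hz, -⟩
  · rw [lt_div_iff₀ (by positivity)] at htc
    nlinarith [Real.cos_le_one |x.arg|]
  · have hden : x + (t : ℂ) ≠ 0 := by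
      intro h
      rw [eq_neg_of_add_eq_zero_left h, norm_neg, Complex.norm_real,
        Real.norm_of_nonneg ht0.le] at hx
      linarith
    have hzx := eq_mul_pow_of_Blaschke_eq (one_add_mul_ne_zero ht0 ht1 hx.le) hden hfix
    have h := abs_arg_le_phie hk ht0 ht1 htc (abs_nonneg _) (Complex.abs_arg_le_pi x) hle'
    rw [← exp_liftedArg_mul_I ht0 ht1] at h
    refine hz.not_ge (le_of_eq_of_le ?_ h)
    rcases abs_choice x.arg with habs | habs
    · rw [habs, ← hxexp, ← hzx]
    · have hconj : Complex.exp (((-x.arg : ℝ) : ℂ) * Complex.I) = conj x := by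
        conv_rhs => rw [hxexp, ← Complex.exp_conj]
        simp
      rw [habs, hconj, ← abs_arg_conj z]
      conv_lhs => rw [hzx]
      simp

theorem stmt6 (k : ℕ) (hk : 2 ≤ k) (t : ℝ) (ht0 : 0 < t) (ht1 : t < 1)
    (z : ℂ) (hz : ‖z‖ = 1) (hbc : belowCurve k t z) :
    Set.MapsTo (Blaschke z t k) (Metric.closedBall 0 1) (Metric.closedBall 0 1) ∧
    (∃ wD : ℂ, ‖wD‖ < 1 ∧ Blaschke z t k wD = wD ∧
      (∀ w : ℂ, ‖w‖ < 1 → Blaschke z t k w = w → w = wD) ∧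
      ∀ w : ℂ, ‖w‖ < 1 →
        Filter.Tendsto (fun n : ℕ => (Blaschke z t k)^[n] w) Filter.atTop (nhds wD)) ∧
    (∀ w0 : (Metric.closedBall (0 : ℂ) 1), ‖(w0 : ℂ)‖ = 1 →
      ¬ EquicontinuousAt
          (fun (n : ℕ) (w : (Metric.closedBall (0 : ℂ) 1)) => (Blaschke z t k)^[n] (w : ℂ))
          w0) := by
  obtain ⟨p, hfix, hp⟩ := exists_fixedPoint_or_not_repelling hk ht0 ht1 hz
  have hp1 : ‖p‖ < 1 := hp.resolve_right fun h =>
    h.2.not_gt (normSq_lt_of_belowCurve hk ht0 ht1 hbc h.1 hfix)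
  exact ⟨mapsTo_Blaschke_closedBall (by omega) ht0 ht1 hz,
    ⟨p, hp1, hfix, fun _ hw hfw => eq_of_isFixedPt_Blaschke hk ht0 ht1 hz hp1 hfix hw hfw,
      fun _ hw => tendsto_iterate_Blaschke hk ht0 ht1 hz hp1 hfix hw⟩,
    not_equicontinuousAt_iterate_Blaschke hk ht0 ht1 hz hp1 hfix⟩
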